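/- Let $T = \langle X_n, Q, \pi, \lambda \rangle$ be a minimal, synchronizing, synchronous invertible transducer with inverse $S = \langle X_n, Q^{-1}, \pi', \lambda' \rangle$, and let $k > 0$ be the minimal synchronizing level of $T$. Then the automaton group $\mathcal{G}(TS)$ generated by the product transducer $TS$ is isomorphic to the subgroup of the symmetric group on $n^k$ points generated by the permutations $\lambda_{TS}(\cdot, p): X_n^k \to X_n^k$ for the states $p$ of $TS$, where $\lambda_{TS}$ is the output function of $TS$. In particular, $\mathcal{G}(TS)$ is finite. -/

import Mathlib

open Classical

noncomputable section

/-- `n`-ary Cantor space: infinite words over the alphabet `Fin n`. -/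
abbrev Cantor (n : ℕ) : Type := ℕ → Fin n

/-- The finite word `w` is a prefix of the infinite word `χ`. -/
def PrefixOf {n : ℕ} (w : List (Fin n)) (χ : Cantor n) : Prop :=
  ∀ (i : ℕ) (h : i < w.length), w.get ⟨i, h⟩ = χ i

/-- Concatenation of a finite word with an infinite word. -/
def appendInf {n : ℕ} (w : List (Fin n)) (χ : Cantor n) : Cantor n :=
  fun i => if h : i < w.length then w.get ⟨i, h⟩ else χ (i - w.length)

/-- The cone (basic clopen set) of infinite words having the finite word `w` as prefix. -/
def cone {n : ℕ} (w : List (Fin n)) : Set (Cantor n) :=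
  {χ | PrefixOf w χ}

/-- The length-`k` prefix of an infinite word, as a finite word. -/
def takeW {n : ℕ} (χ : Cantor n) (k : ℕ) : List (Fin n) :=
  List.ofFn (fun i : Fin k => χ i)

/-- A finite family of finite words forming a maximal antichain:
every infinite word has exactly one member of the family as a prefix. -/
def AntichainFam {n m : ℕ} (α : Fin m → List (Fin n)) : Prop :=
  ∀ χ : Cantor n, ∃! i : Fin m, PrefixOf (α i) χ

/-- The group structure on self-homeomorphisms of a topological space,
with `f * g` acting as `g` followed by `f`. -/
instance homeoGroup {X : Type*} [TopologicalSpace X] : Group (X ≃ₜ X) where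
  mul f g := g.trans f
  one := Homeomorph.refl X
  inv := Homeomorph.symm
  mul_assoc a b c := Homeomorph.ext fun _ => rfl
  one_mul a := Homeomorph.ext fun _ => rfl
  mul_one a := Homeomorph.ext fun _ => rfl
  inv_mul_cancel a := Homeomorph.ext fun x => a.symm_apply_apply x

/-- The Higman–Thompson group `Vₙ`, as the set of self-homeomorphisms of Cantor space
which act by exchanging finite prefixes along a pair of maximal antichains. -/
def Vn (n : ℕ) : Set (Cantor n ≃ₜ Cantor n) :=
  {g | ∃ (m : ℕ) (α β : Fin m → List (Fin n)), AntichainFam α ∧ AntichainFam β ∧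
      ∀ (i : Fin m) (χ : Cantor n), g (appendInf (α i) χ) = appendInf (β i) χ}

/-- Conjugation in the paper's right-action convention: `paperConj g v = g⁻¹ v g`,
i.e. the homeomorphism `x ↦ (x) g⁻¹ v g` (first apply `g⁻¹`, then `v`, then `g`). -/
def paperConj {n : ℕ} (g v : Cantor n ≃ₜ Cantor n) : Cantor n ≃ₜ Cantor n :=
  (g.symm.trans v).trans g

/-- `l` is the longest common prefix of the set `A` of infinite words. -/
def IsLCP {n : ℕ} (A : Set (Cantor n)) (l : List (Fin n)) : Prop :=
  (∀ ρ ∈ A, PrefixOf l ρ) ∧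
    ∀ l' : List (Fin n), (∀ ρ ∈ A, PrefixOf l' ρ) → l'.length ≤ l.length

/-- A (not necessarily finite-state) transducer over the alphabet `Fin n`. -/
structure Transducer (n : ℕ) where
  /-- the set of states -/
  Q : Type
  /-- the transition function -/
  tr : Fin n → Q → Q
  /-- the output (rewrite) function -/
  out : Fin n → Q → List (Fin n)

namespace Transducer

variable {n : ℕ}

/-- The transition function extended to finite words. -/
def transStar (T : Transducer n) : List (Fin n) → T.Q → T.Q
  | [], q => q
  | x :: w, q => T.transStar w (T.tr x q)

/-- The output function extended to finite words. -/
def outStar (T : Transducer n) : List (Fin n) → T.Q → List (Fin n)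
  | [], _ => []
  | x :: w, q => T.out x q ++ T.outStar w (T.tr x q)

/-- The initial transducer `T_q` induces the map `f` on Cantor space: the outputs along
ever longer prefixes of `χ` are ever longer prefixes of `f χ`. -/
def Induces (T : Transducer n) (q : T.Q) (f : Cantor n → Cantor n) : Prop :=
  ∀ (χ : Cantor n) (m : ℕ), ∃ k : ℕ,
    m ≤ (T.outStar (takeW χ k) q).length ∧ PrefixOf (T.outStar (takeW χ k) q) (f χ)

/-- The image of the state `q`: the image of Cantor space under the map induced by `T_q`. -/
def stateImage (T : Transducer n) (q : T.Q) : Set (Cantor n) :=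
  {y | ∃ (f : Cantor n → Cantor n) (χ : Cantor n), T.Induces q f ∧ f χ = y}

/-- `T` is synchronizing at level `k`: the state reached after reading any word of
length `k` does not depend on the starting state. -/
def SyncAtLevel (T : Transducer n) (k : ℕ) : Prop :=
  ∀ w : List (Fin n), w.length = k → ∀ q q' : T.Q, T.transStar w q = T.transStar w q'

/-- `T` is synchronizing if it is synchronizing at some level. -/
def Synchronizing (T : Transducer n) : Prop := ∃ k, T.SyncAtLevel k

/-- `T` (inducing the homeomorphism `h` at `q0`) is one-way synchronizing: `T` is
synchronizing, but the inverse homeomorphism is not induced by any finite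
synchronizing transducer (equivalently, the inverse transducer is not synchronizing). -/
def OneWaySync (T : Transducer n) (q0 : T.Q) (h : Cantor n ≃ₜ Cantor n) : Prop :=
  T.Induces q0 ⇑h ∧ T.Synchronizing ∧
    ¬ ∃ (S : Transducer n) (_ : Finite S.Q) (s0 : S.Q),
        S.Induces s0 ⇑h.symm ∧ S.Synchronizing

/-- `T` is equal to its core : every state is reached by reading a word of length `k`
from some state, for every synchronizing level `k`. -/
def EqualToCore (T : Transducer n) : Prop :=
  ∀ k : ℕ, T.SyncAtLevel k → ∀ q : T.Q, ∃ (w : List (Fin n)) (p : T.Q),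
    w.length = k ∧ T.transStar w p = q

/-- Every state of `T` is accessible from `q0`. -/
def Accessible (T : Transducer n) (q0 : T.Q) : Prop :=
  ∀ q : T.Q, ∃ w : List (Fin n), T.transStar w q0 = q

/-- The product transducer `T S` (first act by `T`, then by `S`). -/
def prod (T S : Transducer n) : Transducer n where
  Q := T.Q × S.Q
  tr := fun x p => (T.tr x p.1, S.transStar (T.out x p.1) p.2)
  out := fun x p => S.outStar (T.out x p.1) p.2

/-- `T` is partially invertible: every state induces an injective map on Cantor space
with clopen image. -/
def PartiallyInvertible (T : Transducer n) : Prop :=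
  ∀ q : T.Q, ∃ f : Cantor n → Cantor n,
    T.Induces q f ∧ Function.Injective f ∧ IsClopen (Set.range f)

/-- `T` has no states of incomplete response: for each state `q` and letter `i`, no word
strictly longer than `λ(i,q)` is a common prefix of the outputs on all of the cone `[i]`. -/
def NoIncompleteResponse (T : Transducer n) : Prop :=
  ∀ (q : T.Q) (i x : Fin n),
    ¬ ∀ χ : Cantor n, ∃ k : ℕ, (T.out i q ++ [x]) <+: T.outStar (i :: takeW χ k) q

/-- States `q` of `T` and `p` of `S` are `ω`-equivalent: they induce one and the same
map on Cantor space. -/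
def OmegaEq (T : Transducer n) (q : T.Q) (S : Transducer n) (p : S.Q) : Prop :=
  ∃ f : Cantor n → Cantor n, T.Induces q f ∧ S.Induces p f

/-- `T` is minimal: no states of incomplete response and no pair of distinct
`ω`-equivalent states. -/
def Minimal (T : Transducer n) : Prop :=
  T.NoIncompleteResponse ∧ ∀ q q' : T.Q, T.OmegaEq q T q' → q = q'

/-- The map on Cantor space induced by the state `q` (junk value if none exists). -/
def inducedMap (T : Transducer n) (q : T.Q) : Cantor n → Cantor n :=
  if h : ∃ f, T.Induces q f then h.choose else id

/-- `𝓛_q(α)`: the longest common prefix of the preimage of the cone `[α]` under `T_q`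
(junk value if it does not exist). -/
def lcp (T : Transducer n) (q : T.Q) (α : List (Fin n)) : List (Fin n) :=
  if h : ∃ l, IsLCP {ρ : Cantor n | T.inducedMap q ρ ∈ cone α} l then h.choose else []

/-- The inverse transducer of `T` given by the inversion algorithm, on the set of all
pairs `(w, q)`: reading `x` from `(w,q)` outputs `𝓛_q(wx)` and moves to
`(wx - λ(𝓛_q(wx), q), π(𝓛_q(wx), q))`. -/
def invT (T : Transducer n) : Transducer n where
  Q := List (Fin n) × T.Q
  tr := fun x p =>
    ((p.1 ++ [x]).drop (T.outStar (T.lcp p.2 (p.1 ++ [x])) p.2).length,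
      T.transStar (T.lcp p.2 (p.1 ++ [x])) p.2)
  out := fun x p => T.lcp p.2 (p.1 ++ [x])

/-- Restriction of a transducer to a set of states (transitions leaving the set are
replaced by junk loops; for transition-closed sets this is the honest restriction). -/
def restrictTo (T : Transducer n) (P : T.Q → Prop) : Transducer n where
  Q := {q : T.Q // P q}
  tr := fun x q => if h : P (T.tr x q.1) then ⟨T.tr x q.1, h⟩ else q
  out := fun x q => T.out x q.1

/-- The set of states reachable from `q0`. -/
def reach (T : Transducer n) (q0 : T.Q) : T.Q → Prop :=
  fun q => ∃ w : List (Fin n), T.transStar w q0 = q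

/-- The inverse transducer of the initial transducer `T_{q0}`, with state set the states
accessible from `(ε, q0)`. -/
def invAcc (T : Transducer n) (q0 : T.Q) : Transducer n :=
  (T.invT).restrictTo ((T.invT).reach ([], q0))

/-- A pair `(w,p)` is good if `[w] ⊆ im(T_p)` and `𝓛_p(w) = ε`. -/
def GoodPair (T : Transducer n) (p : List (Fin n) × T.Q) : Prop :=
  cone p.1 ⊆ T.stateImage p.2 ∧
    IsLCP {ρ : Cantor n | T.inducedMap p.2 ρ ∈ cone p.1} []

/-- The partial inverse `T'` of a partially invertible transducer `T`: the inverse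
transducer restricted to the good pairs `(w,p)` with `[w] ⊆ im(T_p)`, `𝓛_p(w) = ε`. -/
def partialInv (T : Transducer n) : Transducer n :=
  (T.invT).restrictTo T.GoodPair

/-- `h` is a completion of `T`: there are a maximal antichain `η` and an effective viable
combination `(ρ, p)` such that `h` maps `η_i χ` to `ρ_i (χ)T_{p_i}`. -/
def IsCompletion (T : Transducer n) (h : Cantor n ≃ₜ Cantor n) : Prop :=
  ∃ (l : ℕ) (η ρ : Fin l → List (Fin n)) (p : Fin l → T.Q)
      (f : Fin l → (Cantor n → Cantor n)),
    l % (n - 1) = 1 % (n - 1) ∧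
    AntichainFam η ∧
    (∀ i, T.Induces (p i) (f i)) ∧
    (⋃ i, appendInf (ρ i) '' Set.range (f i)) = Set.univ ∧
    (∀ i j, i ≠ j →
      Disjoint (appendInf (ρ i) '' Set.range (f i))
        (appendInf (ρ j) '' Set.range (f j))) ∧
    ∀ (i : Fin l) (χ : Cantor n), h (appendInf (η i) χ) = appendInf (ρ i) (f i χ)

/-- The group `𝓗(T)` generated by all completions of `T`. -/
def HGroup (T : Transducer n) : Subgroup (Cantor n ≃ₜ Cantor n) :=
  Subgroup.closure {h | T.IsCompletion h}

/-- The subgroup-generating equivalence relation induced by the automaton underlying a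
transducer `A` with start state `a0` (by Lemma 4.1, two words are related iff the states
they reach are identified by the collapsing procedure, i.e. iff the reached states
transition identically on all sufficiently long words). -/
def simA (A : Transducer n) (a0 : A.Q) (α β : List (Fin n)) : Prop :=
  ∃ i : ℕ, ∀ w : List (Fin n), w.length = i →
    A.transStar w (A.transStar α a0) = A.transStar w (A.transStar β a0)

/-- `if b then T else T'`. -/
def factor (T : Transducer n) (b : Bool) : Transducer n :=
  if b then T else T.partialInv

/-- The product of a nonempty list of factors, each equal to `T` or its partial
inverse `T'`; these products make up the set `Π(T)`. -/
def prodOf (T : Transducer n) : List Bool → Transducer n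
  | [] => T
  | [b] => T.factor b
  | b :: c :: rest => (T.factor b).prod (T.prodOf (c :: rest))

/-- `T` is contracting: every state of every product of copies of `T` and `T'` is
`ω`-equivalent to an initial transducer which, after reading some fixed length of input,
always acts as a state of `T`. -/
def Contracting (T : Transducer n) : Prop :=
  ∀ L : List Bool, L ≠ [] → ∀ q : (T.prodOf L).Q,
    ∃ (V : Transducer n) (p : V.Q) (f : Cantor n → Cantor n),
      (T.prodOf L).Induces q f ∧ V.Induces p f ∧
      ∃ j : ℕ, ∀ w : List (Fin n), w.length = j →
        ∃ (u : T.Q) (g : Cantor n → Cantor n),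
          V.Induces (V.transStar w p) g ∧ T.Induces u g

end Transducer

/-- The element `v` of `Vₙ` preserves the relation `r` on nonempty finite words:
whenever `v` replaces the prefix `α` by `β`, the words `α` and `β` are related. -/
def PreservesRel {n : ℕ} (r : List (Fin n) → List (Fin n) → Prop)
    (g : Cantor n ≃ₜ Cantor n) : Prop :=
  ∀ (α β : List (Fin n)), α ≠ [] → β ≠ [] →
    (∀ χ : Cantor n, g (appendInf α χ) = appendInf β χ) → r α β

/-- The subgroup `V_∼` of `Vₙ` generated by the prefix-exchange homeomorphisms
preserving the relation `r`. -/
def VSim (n : ℕ) (r : List (Fin n) → List (Fin n) → Prop) :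
    Subgroup (Cantor n ≃ₜ Cantor n) :=
  Subgroup.closure {g | g ∈ Vn n ∧ PreservesRel r g}

/-- `f` coincides with `g` on the cone `[α]` (conjugated into the cone) and is the
identity off the cone: the homeomorphism `[α]_g`. -/
def IsRestrTo {n : ℕ} (α : List (Fin n)) (g f : Cantor n ≃ₜ Cantor n) : Prop :=
  (∀ χ : Cantor n, f (appendInf α χ) = appendInf α (g χ)) ∧
  ∀ χ : Cantor n, ¬ PrefixOf α χ → f χ = χ

/-- The Nekrashevych group `Vₙ(G)`: the group generated by `Vₙ` together with all the
homeomorphisms `[α]_g` for `g ∈ G`. -/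
def NekG (n : ℕ) (G : Subgroup (Cantor n ≃ₜ Cantor n)) :
    Subgroup (Cantor n ≃ₜ Cantor n) :=
  Subgroup.closure (Vn n ∪ {f | ∃ (α : List (Fin n)) (g : Cantor n ≃ₜ Cantor n),
    g ∈ G ∧ IsRestrTo α g f})

/-- The homeomorphism `f` locally agrees with the set `G` of homeomorphisms. -/
def LocallyAgrees {n : ℕ} (G : Set (Cantor n ≃ₜ Cantor n))
    (f : Cantor n ≃ₜ Cantor n) : Prop :=
  ∀ x : Cantor n, ∃ U : Set (Cantor n), IsOpen U ∧ x ∈ U ∧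
    ∃ g ∈ G, Set.EqOn ⇑f ⇑g U

/-- A finite synchronous invertible transducer over `Fin n`: each state rewrites single
letters to single letters bijectively. -/
structure SyncTransducer (n : ℕ) where
  /-- the set of states -/
  Q : Type
  /-- there are finitely many states -/
  fin : Finite Q
  /-- the transition function -/
  tr : Fin n → Q → Q
  /-- the (single-letter) output function -/
  out : Fin n → Q → Fin n
  /-- each state rewrites letters bijectively -/
  bij : ∀ q : Q, Function.Bijective fun x => out x q

namespace SyncTransducer

variable {n : ℕ}

/-- The transition function extended to finite words. -/
def trStar (U : SyncTransducer n) : List (Fin n) → U.Q → U.Q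
  | [], q => q
  | x :: w, q => U.trStar w (U.tr x q)

/-- The output function extended to finite words. -/
def outWord (U : SyncTransducer n) : List (Fin n) → U.Q → List (Fin n)
  | [], _ => []
  | x :: w, q => U.out x q :: U.outWord w (U.tr x q)

/-- The map on Cantor space induced by the initial transducer `U_q`. -/
def applyFun (U : SyncTransducer n) (q : U.Q) (χ : Cantor n) : Cantor n :=
  fun i => U.out (χ i) (U.trStar (takeW χ i) q)

/-- The inverse transducer of a synchronous invertible transducer. -/
def inv (U : SyncTransducer n) : SyncTransducer n where
  Q := U.Q
  fin := U.fin
  tr := fun y q => U.tr ((Equiv.ofBijective _ (U.bij q)).symm y) q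
  out := fun y q => (Equiv.ofBijective _ (U.bij q)).symm y
  bij := fun q => (Equiv.ofBijective _ (U.bij q)).symm.bijective

/-- The product of synchronous transducers (first act by `T`, then by `S`). -/
def sprod (T S : SyncTransducer n) : SyncTransducer n where
  Q := T.Q × S.Q
  fin := by
    haveI := T.fin; haveI := S.fin
    infer_instance
  tr := fun x p => (T.tr x p.1, S.tr (T.out x p.1) p.2)
  out := fun x p => S.out (T.out x p.1) p.2
  bij := fun p => (S.bij p.2).comp (T.bij p.1)

/-- `U` is synchronizing at level `k`. -/
def SyncAtLevel (U : SyncTransducer n) (k : ℕ) : Prop :=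
  ∀ w : List (Fin n), w.length = k → ∀ q q' : U.Q, U.trStar w q = U.trStar w q'

/-- `U` is synchronizing. -/
def Synchronizing (U : SyncTransducer n) : Prop := ∃ k, U.SyncAtLevel k

/-- `U` is minimal (under `ω`-equivalence): distinct states induce distinct maps. -/
def Minimal (U : SyncTransducer n) : Prop :=
  ∀ q q' : U.Q, U.applyFun q = U.applyFun q' → q = q'

/-- One-way synchronizing: `U` is synchronizing but the inverse homeomorphism of
`h = U_{q0}` is not induced by any finite synchronizing transducer. -/
def OneWaySync (U : SyncTransducer n) (h : Cantor n ≃ₜ Cantor n) : Prop :=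
  U.Synchronizing ∧
    ¬ ∃ (S : Transducer n) (_ : Finite S.Q) (s0 : S.Q),
        S.Induces s0 ⇑h.symm ∧ S.Synchronizing

/-- `U` is equal to its core. -/
def EqualToCore (U : SyncTransducer n) : Prop :=
  ∀ k : ℕ, U.SyncAtLevel k → ∀ q : U.Q, ∃ (w : List (Fin n)) (p : U.Q),
    w.length = k ∧ U.trStar w p = q

/-- The underlying (asynchronous-format) transducer of a synchronous transducer. -/
def toT (U : SyncTransducer n) : Transducer n :=
  ⟨U.Q, U.tr, fun x q => [U.out x q]⟩

/-- The automaton group `𝒢(U)` generated by `U`: the subgroup of the homeomorphism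
group of Cantor space generated by the homeomorphisms `U_q` for the states `q`. -/
def autG (U : SyncTransducer n) : Subgroup (Cantor n ≃ₜ Cantor n) :=
  Subgroup.closure {f : Cantor n ≃ₜ Cantor n | ∃ q : U.Q, ⇑f = U.applyFun q}

end SyncTransducer

/-- The infinite word obtained by deleting the first `k` letters. -/
def dropInf {n : ℕ} (k : ℕ) (χ : Cantor n) : Cantor n := fun i => χ (i + k)

section Words

variable {n : ℕ}

@[simp] theorem length_takeW (χ : Cantor n) (k : ℕ) : (takeW χ k).length = k := by
  simp [takeW]

theorem takeW_succ (χ : Cantor n) (k : ℕ) :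
    takeW χ (k + 1) = χ 0 :: takeW (dropInf 1 χ) k := by
  simp [takeW, dropInf, List.ofFn_succ]

theorem takeW_congr {χ χ' : Cantor n} {k : ℕ} (h : ∀ j < k, χ j = χ' j) :
    takeW χ k = takeW χ' k := by
  simp only [takeW]
  congr 1
  funext i
  exact h i i.2

theorem dropInf_succ (k : ℕ) (χ : Cantor n) :
    dropInf (k + 1) χ = dropInf k (dropInf 1 χ) := by
  funext i
  simp [dropInf, add_assoc]

theorem takeW_appendInf (w : List (Fin n)) (χ : Cantor n) :
    takeW (appendInf w χ) w.length = w := by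
  apply List.ext_get (by simp)
  intro i h₁ h₂
  simp [takeW, appendInf]

theorem dropInf_appendInf (w : List (Fin n)) (χ : Cantor n) :
    dropInf w.length (appendInf w χ) = χ := by
  funext i
  simp [dropInf, appendInf]

theorem appendInf_takeW_dropInf (k : ℕ) (χ : Cantor n) :
    appendInf (takeW χ k) (dropInf k χ) = χ := by
  funext i
  by_cases h : i < k
  · simp [appendInf, takeW, h]
  · simp [appendInf, dropInf, h, Nat.sub_add_cancel (not_lt.mp h)]

/-- A map on Cantor space is continuous if each letter of the image is determined by a finite
prefix of the argument. -/
theorem continuous_of_finite_dependence {F : Cantor n → Cantor n}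
    (h : ∀ i, ∃ m, ∀ χ χ' : Cantor n, (∀ j < m, χ j = χ' j) → F χ i = F χ' i) :
    Continuous F := by
  refine continuous_pi fun i => ?_
  obtain ⟨m, hm⟩ := h i
  refine (IsLocallyConstant.iff_exists_open _).2 (fun χ => ?_) |>.continuous
  refine ⟨⋂ j ∈ Finset.range m, {χ' : Cantor n | χ' j = χ j}, ?_, ?_, ?_⟩
  · refine isOpen_biInter_finset fun j _ => ?_
    exact (isOpen_discrete ({χ j} : Set (Fin n))).preimage
      (continuous_apply (A := fun _ : ℕ => Fin n) j)
  · simp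
  · intro χ' hχ'
    refine hm χ' χ fun j hj => ?_
    simp only [Set.mem_iInter, Finset.mem_range] at hχ'
    exact hχ' j hj

instance finite_words (n k : ℕ) : Finite {l : List (Fin n) // l.length = k} :=
  (List.finite_length_eq (Fin n) k).to_subtype

end Words

namespace SyncTransducer

variable {n : ℕ} (U : SyncTransducer n)

theorem applyFun_zero (q : U.Q) (χ : Cantor n) : U.applyFun q χ 0 = U.out (χ 0) q := by
  simp [applyFun, takeW, trStar]

theorem applyFun_succ (q : U.Q) (χ : Cantor n) (i : ℕ) :
    U.applyFun q χ (i + 1) = U.applyFun (U.tr (χ 0) q) (dropInf 1 χ) i := by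
  simp [applyFun, takeW_succ, trStar, dropInf]

theorem dropInf_one_applyFun (q : U.Q) (χ : Cantor n) :
    dropInf 1 (U.applyFun q χ) = U.applyFun (U.tr (χ 0) q) (dropInf 1 χ) :=
  funext fun i => U.applyFun_succ q χ i

theorem takeW_applyFun (k : ℕ) (q : U.Q) (χ : Cantor n) :
    takeW (U.applyFun q χ) k = U.outWord (takeW χ k) q := by
  induction k generalizing q χ with
  | zero => rfl
  | succ k ih =>
    rw [takeW_succ, takeW_succ, applyFun_zero, dropInf_one_applyFun, ih, outWord]

theorem dropInf_applyFun (k : ℕ) (q : U.Q) (χ : Cantor n) :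
    dropInf k (U.applyFun q χ) = U.applyFun (U.trStar (takeW χ k) q) (dropInf k χ) := by
  induction k generalizing q χ with
  | zero => rfl
  | succ k ih =>
    rw [dropInf_succ, dropInf_one_applyFun, ih, takeW_succ, trStar, ← dropInf_succ]

theorem applyFun_congr (q : U.Q) {χ χ' : Cantor n} {i : ℕ} (h : ∀ j ≤ i, χ j = χ' j) :
    U.applyFun q χ i = U.applyFun q χ' i := by
  simp only [applyFun]
  rw [h i le_rfl, takeW_congr fun j hj => h j hj.le]

@[simp] theorem length_outWord (w : List (Fin n)) (q : U.Q) :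
    (U.outWord w q).length = w.length := by
  induction w generalizing q with
  | nil => rfl
  | cons x w ih => simp [outWord, ih]

theorem outWord_injective (q : U.Q) : Function.Injective fun w => U.outWord w q := by
  intro w
  induction w generalizing q with
  | nil =>
    intro w' h
    cases w' with
    | nil => rfl
    | cons => simp [outWord] at h
  | cons x w ih =>
    intro w' h
    cases w' with
    | nil => simp [outWord] at h
    | cons y w' =>
      simp only [outWord, List.cons.injEq] at h
      obtain rfl : x = y := (U.bij q).1 h.1
      rw [ih _ h.2]

/-- The state of the inverse transducer corresponding to the state `q`. -/
def invState (q : U.Q) : U.inv.Q := q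

/-- The state of the product of `U` with its inverse given by two states of `U`. -/
def pairState (s t : U.Q) : (U.sprod U.inv).Q := (s, t)

theorem out_inv_out (y : Fin n) (q : U.Q) : U.out (U.inv.out y (U.invState q)) q = y :=
  (Equiv.ofBijective _ (U.bij q)).apply_symm_apply y

theorem inv_out_out (x : Fin n) (q : U.Q) : U.inv.out (U.out x q) (U.invState q) = x :=
  (Equiv.ofBijective _ (U.bij q)).symm_apply_apply x

theorem inv_tr (y : Fin n) (q : U.Q) :
    U.inv.tr y (U.invState q) = U.invState (U.tr (U.inv.out y (U.invState q)) q) := rfl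

theorem out_sprod_inv_out (x : Fin n) (s t : U.Q) :
    U.out ((U.sprod U.inv).out x (U.pairState s t)) t = U.out x s :=
  U.out_inv_out (U.out x s) t

theorem sprod_inv_tr (x : Fin n) (s t : U.Q) :
    (U.sprod U.inv).tr x (U.pairState s t) =
      U.pairState (U.tr x s) (U.tr ((U.sprod U.inv).out x (U.pairState s t)) t) := rfl

theorem applyFun_inv_applyFun (q : U.Q) (χ : Cantor n) :
    U.applyFun q (U.inv.applyFun (U.invState q) χ) = χ := by
  funext i
  induction i generalizing q χ with
  | zero => rw [applyFun_zero, applyFun_zero, out_inv_out]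
  | succ i ih =>
    rw [applyFun_succ, applyFun_zero, dropInf_one_applyFun, inv_tr, ih]
    rfl

theorem inv_applyFun_applyFun (q : U.Q) (χ : Cantor n) :
    U.inv.applyFun (U.invState q) (U.applyFun q χ) = χ := by
  funext i
  induction i generalizing q χ with
  | zero => rw [applyFun_zero, applyFun_zero, inv_out_out]
  | succ i ih =>
    rw [applyFun_succ, applyFun_zero, dropInf_one_applyFun, inv_tr, inv_out_out, ih]
    rfl

/-- The state `(s, t)` of the product of `U` with its inverse acts as `U_s` followed by the
inverse of `U_t`. -/
theorem applyFun_sprod_inv_applyFun (s t : U.Q) (χ : Cantor n) :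
    U.applyFun t ((U.sprod U.inv).applyFun (U.pairState s t) χ) = U.applyFun s χ := by
  funext i
  induction i generalizing s t χ with
  | zero => rw [applyFun_zero, applyFun_zero, applyFun_zero, out_sprod_inv_out]
  | succ i ih =>
    rw [applyFun_succ, applyFun_zero, dropInf_one_applyFun, applyFun_succ, sprod_inv_tr, ih]

theorem trStar_sprod_inv (w : List (Fin n)) (s t : U.Q) :
    (U.sprod U.inv).trStar w (U.pairState s t) = U.pairState (U.trStar w s)
      (U.trStar ((U.sprod U.inv).outWord w (U.pairState s t)) t) := by
  induction w generalizing s t with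
  | nil => rfl
  | cons x w ih => exact ih _ _

/-- Cantor space as the product of the words of length `k` with Cantor space, where the tail
following the prefix `w` is transformed by `U_{f w}`. -/
def prefixEquiv (k : ℕ) (f : List (Fin n) → U.Q) :
    Cantor n ≃ {l : List (Fin n) // l.length = k} × Cantor n where
  toFun χ := (⟨takeW χ k, length_takeW χ k⟩, U.applyFun (f (takeW χ k)) (dropInf k χ))
  invFun a := appendInf a.1.val (U.inv.applyFun (U.invState (f a.1.val)) a.2)
  left_inv χ := by
    simp only
    rw [inv_applyFun_applyFun, appendInf_takeW_dropInf]
  right_inv := by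
    rintro ⟨⟨w, rfl⟩, χ⟩
    simp only [takeW_appendInf, dropInf_appendInf, applyFun_inv_applyFun]

/-- The action on Cantor space of a permutation of the words of length `k`, transported
along `prefixEquiv`. -/
def prefixMap (k : ℕ) (f : List (Fin n) → U.Q)
    (σ : Equiv.Perm {l : List (Fin n) // l.length = k}) (χ : Cantor n) : Cantor n :=
  (U.prefixEquiv k f).symm (σ (U.prefixEquiv k f χ).1, (U.prefixEquiv k f χ).2)

theorem prefixMap_mul (k : ℕ) (f : List (Fin n) → U.Q)
    (σ τ : Equiv.Perm {l : List (Fin n) // l.length = k}) (χ : Cantor n) :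
    U.prefixMap k f (σ * τ) χ = U.prefixMap k f σ (U.prefixMap k f τ χ) := by
  simp [prefixMap]

theorem prefixMap_one (k : ℕ) (f : List (Fin n) → U.Q) (χ : Cantor n) :
    U.prefixMap k f 1 χ = χ := by
  simp [prefixMap]

theorem continuous_prefixMap (k : ℕ) (f : List (Fin n) → U.Q)
    (σ : Equiv.Perm {l : List (Fin n) // l.length = k}) :
    Continuous (U.prefixMap k f σ) := by
  refine continuous_of_finite_dependence fun i => ⟨i + k + 1, fun χ χ' h => ?_⟩
  have hw : takeW χ k = takeW χ' k := takeW_congr fun j hj => h j (by omega)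
  simp only [prefixMap, prefixEquiv, Equiv.coe_fn_mk, Equiv.coe_fn_symm_mk, hw, appendInf]
  split_ifs
  · rfl
  · refine applyFun_congr _ _ fun j hj => applyFun_congr _ _ fun l hl => h _ ?_
    omega

/-- The homomorphism from permutations of the words of length `k` to homeomorphisms of Cantor
space given by `prefixMap`. -/
def prefixHom (k : ℕ) (f : List (Fin n) → U.Q) :
    Equiv.Perm {l : List (Fin n) // l.length = k} →* (Cantor n ≃ₜ Cantor n) where
  toFun σ :=
    { toFun := U.prefixMap k f σ
      invFun := U.prefixMap k f σ⁻¹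
      left_inv := fun χ => by rw [← prefixMap_mul, inv_mul_cancel, prefixMap_one]
      right_inv := fun χ => by rw [← prefixMap_mul, mul_inv_cancel, prefixMap_one]
      continuous_toFun := U.continuous_prefixMap k f σ
      continuous_invFun := U.continuous_prefixMap k f σ⁻¹ }
  map_one' := Homeomorph.ext (U.prefixMap_one k f)
  map_mul' σ τ := Homeomorph.ext (U.prefixMap_mul k f σ τ)

@[simp] theorem coe_prefixHom (k : ℕ) (f : List (Fin n) → U.Q)
    (σ : Equiv.Perm {l : List (Fin n) // l.length = k}) :
    ⇑(U.prefixHom k f σ) = U.prefixMap k f σ := rfl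

theorem prefixHom_injective [Nonempty (Fin n)] (k : ℕ) (f : List (Fin n) → U.Q) :
    Function.Injective (U.prefixHom k f) := by
  intro σ τ h
  obtain ⟨χ⟩ : Nonempty (Cantor n) := inferInstance
  ext1 w
  have := congrArg (fun g => U.prefixEquiv k f (g ((U.prefixEquiv k f).symm (w, χ)))) h
  simpa [prefixMap] using this

theorem prefixMap_eq_applyFun {k : ℕ} {f : List (Fin n) → U.Q}
    (hf : ∀ w : List (Fin n), w.length = k → ∀ q, U.trStar w q = f w)
    {σ : Equiv.Perm {l : List (Fin n) // l.length = k}} {p : (U.sprod U.inv).Q}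
    (hσ : ∀ w : {l : List (Fin n) // l.length = k},
      (σ w).val = (U.sprod U.inv).outWord w.val p) :
    U.prefixMap k f σ = (U.sprod U.inv).applyFun p := by
  funext χ
  obtain ⟨s, t, rfl⟩ : ∃ s t, p = U.pairState s t := ⟨p.1, p.2, rfl⟩
  rw [prefixMap, Equiv.symm_apply_eq]
  refine Prod.ext (Subtype.ext ?_) ?_
  · simp only [prefixEquiv, Equiv.coe_fn_mk, hσ, takeW_applyFun]
  · simp only [prefixEquiv, Equiv.coe_fn_mk]
    rw [takeW_applyFun, dropInf_applyFun, trStar_sprod_inv, hf _ (by simp), hf _ (by simp),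
      applyFun_sprod_inv_applyFun]

/-- The permutation of the words of length `k` induced by a state. -/
def wordPerm (k : ℕ) (q : U.Q) : Equiv.Perm {l : List (Fin n) // l.length = k} :=
  Equiv.ofBijective (fun w => ⟨U.outWord w.val q, by rw [length_outWord, w.2]⟩)
    (Finite.injective_iff_bijective.mp fun _ _ h =>
      Subtype.ext (U.outWord_injective q (Subtype.ext_iff.mp h)))

theorem autG_sprod_inv_eq_map {k : ℕ} {f : List (Fin n) → U.Q}
    (hf : ∀ w : List (Fin n), w.length = k → ∀ q, U.trStar w q = f w) :
    (U.sprod U.inv).autG = (Subgroup.closure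
      {σ : Equiv.Perm {l : List (Fin n) // l.length = k} | ∃ p : (U.sprod U.inv).Q,
        ∀ w : {l : List (Fin n) // l.length = k},
          (σ w).val = (U.sprod U.inv).outWord w.val p}).map (U.prefixHom k f) := by
  rw [MonoidHom.map_closure, autG]
  congr 1
  ext g
  constructor
  · rintro ⟨p, hp⟩
    refine ⟨(U.sprod U.inv).wordPerm k p, ⟨p, fun w => rfl⟩, DFunLike.coe_injective ?_⟩
    rw [coe_prefixHom, hp]
    exact U.prefixMap_eq_applyFun hf fun w => rfl
  · rintro ⟨σ, ⟨p, hp⟩, rfl⟩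
    exact ⟨p, U.prefixMap_eq_applyFun hf hp⟩

end SyncTransducer

/-- Propositions 1.3/3.2. Let `U` be a minimal, synchronizing,
synchronous invertible transducer with inverse `S = U.inv` and minimal synchronizing
level `k > 0`.  Then the automaton group `𝒢(US)` is isomorphic to the subgroup of the
symmetric group on the `n^k` words of length `k` generated by the permutations
`w ↦ λ_{US}(w, p)` for the states `p` of `US`; in particular `𝒢(US)` is finite. -/
theorem autG_of_TS_iso_subgroup_of_symmetric_group
    {n : ℕ} (hn : 2 ≤ n) (U : SyncTransducer n) (hmin : U.Minimal)
    (k : ℕ) (hk : 0 < k) (hleast : IsLeast {j | U.SyncAtLevel j} k) :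
    Nonempty
      (↥(SyncTransducer.autG (U.sprod U.inv)) ≃*
        ↥(Subgroup.closure
          {σ : Equiv.Perm {l : List (Fin n) // l.length = k} |
            ∃ p : (U.sprod U.inv).Q,
              ∀ w : {l : List (Fin n) // l.length = k},
                (σ w).val = (U.sprod U.inv).outWord w.val p})) ∧
    Finite ↥(SyncTransducer.autG (U.sprod U.inv)) := by
  have : Nonempty (Fin n) := ⟨⟨0, by omega⟩⟩
  have key : Nonempty (↥(SyncTransducer.autG (U.sprod U.inv)) ≃*
      ↥(Subgroup.closure
        {σ : Equiv.Perm {l : List (Fin n) // l.length = k} |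
          ∃ p : (U.sprod U.inv).Q,
            ∀ w : {l : List (Fin n) // l.length = k},
              (σ w).val = (U.sprod U.inv).outWord w.val p})) := by
    rcases isEmpty_or_nonempty U.Q with hQ | ⟨⟨q₀⟩⟩
    · have h : (U.sprod U.inv).autG = ⊥ := by
        rw [SyncTransducer.autG, Subgroup.closure_eq_bot_iff]
        rintro g ⟨p, -⟩
        exact hQ.elim p.1
      rw [h, Subgroup.closure_eq_bot_iff.2]
      · exact ⟨MulEquiv.ofUnique⟩
      · rintro σ ⟨p, -⟩
        exact hQ.elim p.1
    · rw [U.autG_sprod_inv_eq_map (f := fun w => U.trStar w q₀)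
        fun w hw q => hleast.1 w hw q q₀]
      exact ⟨(Subgroup.equivMapOfInjective _ _ (U.prefixHom_injective k _)).symm⟩
  obtain ⟨e⟩ := key
  exact ⟨⟨e⟩, Finite.of_equiv _ e.symm.toEquiv⟩
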